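/- Let G be a group, φ an automorphism of G, H a normal subgroup of G with φ(H) = H, and suppose the quotient G/H is finitely generated and residually finite; let φ̄ be the induced automorphism of G/H and φ' the restriction of φ to H. Then R(φ) < ∞ if and only if R(φ̄) < ∞ and R((τ_g ∘ φ)|_H) < ∞ for every g ∈ G, where τ_g is the inner automorphism x ↦ g·x·g⁻¹ (note that τ_g ∘ φ maps H to H since H is normal). -/

import Mathlib

/-- Twisted conjugacy relation for an automorphism `φ` of `G`:
`x ∼ y` iff `y = h * x * φ(h)⁻¹` for some `h`. -/
def twistedConj {G : Type*} [Group G] (φ : G ≃* G) (x y : G) : Prop :=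
  ∃ h : G, y = h * x * (φ h)⁻¹

/-- The set of Reidemeister (twisted conjugacy) classes of `φ`.
Its cardinality is the Reidemeister number `R(φ)`. -/
def ReidemeisterClasses {G : Type*} [Group G] (φ : G ≃* G) := Quot (twistedConj φ)

/-- A group is residually finite if every nontrivial element survives in some finite
quotient, i.e. avoids some finite-index normal subgroup (the kernel of a homomorphism to
a finite group). -/
def ResiduallyFinite (G : Type*) [Group G] : Prop :=
  ∀ g : G, g ≠ 1 → ∃ N : Subgroup G, N.Normal ∧ Finite (G ⧸ N) ∧ g ∉ N

/-- For fixed `k` and `q`, the denominators occurring in a representation of `q` as a sum of at most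
`k` unit fractions are bounded. -/
theorem exists_bound_of_sum_inv_eq (k : ℕ) : ∀ q : ℚ, ∃ B : ℕ, ∀ s : Multiset ℕ,
    s.card ≤ k → (∀ n ∈ s, 0 < n) → (s.map fun n : ℕ => (n : ℚ)⁻¹).sum = q → ∀ n ∈ s, n ≤ B := by
  induction k with
  | zero =>
    intro q
    refine ⟨0, fun s hs _ _ n hn => ?_⟩
    rw [Multiset.card_eq_zero.mp (Nat.le_zero.mp hs)] at hn
    simp at hn
  | succ k ih =>
    intro q
    choose B hB using fun m : ℕ => ih (q - (m : ℚ)⁻¹)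
    let M := ⌈((k : ℚ) + 1) / q⌉₊
    refine ⟨M + ∑ m ∈ Finset.range (M + 1), B m, fun s hs hpos hsum n hn => ?_⟩
    have hq : 0 < q := by
      obtain ⟨t, rfl⟩ := Multiset.exists_cons_of_mem hn
      rw [← hsum, Multiset.map_cons, Multiset.sum_cons]
      have h1 : (0 : ℚ) < (n : ℚ)⁻¹ := inv_pos.mpr (Nat.cast_pos.mpr (hpos n hn))
      have h2 : 0 ≤ (t.map fun n : ℕ => (n : ℚ)⁻¹).sum := Multiset.sum_nonneg (by simp)
      linarith
    obtain ⟨m, hm, hmM⟩ : ∃ m ∈ s, m ≤ M := by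
      by_contra! hlt
      have hM : ((k : ℚ) + 1) / q ≤ M := Nat.le_ceil _
      have hM0 : (0 : ℚ) < M := lt_of_lt_of_le (by positivity) hM
      have hlt' : ∀ x ∈ s, (x : ℚ)⁻¹ < (M : ℚ)⁻¹ := fun x hx =>
        inv_strictAnti₀ hM0 (Nat.cast_lt.mpr (hlt x hx))
      have hbound : (s.map fun n : ℕ => (n : ℚ)⁻¹).sum < (s.map fun _ => (M : ℚ)⁻¹).sum :=
        Multiset.sum_lt_sum_of_nonempty (by rintro rfl; simp at hn) hlt'
      rw [hsum, Multiset.map_const', Multiset.sum_replicate, nsmul_eq_mul, ← div_eq_mul_inv,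
        lt_div_iff₀ hM0] at hbound
      rw [div_le_iff₀ hq] at hM
      have hcard : (s.card : ℚ) ≤ k + 1 := by exact_mod_cast hs
      linarith
    obtain ⟨t, rfl⟩ := Multiset.exists_cons_of_mem hm
    rcases Multiset.mem_cons.mp hn with rfl | hnt
    · omega
    · have hnB : n ≤ B m := by
        refine hB m t (by simpa using hs) (fun x hx => hpos x (Multiset.mem_cons_of_mem hx)) ?_ n hnt
        rw [← hsum, Multiset.map_cons, Multiset.sum_cons]
        ring
      have := Finset.single_le_sum (f := B) (fun _ _ => Nat.zero_le _)
        (Finset.mem_range.mpr (Order.lt_add_one_iff.mpr hmM))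
      omega

theorem twistedConj_equivalence {G : Type*} [Group G] (φ : G ≃* G) :
    Equivalence (twistedConj φ) where
  refl x := ⟨1, by simp⟩
  symm := by
    rintro x _ ⟨h, rfl⟩
    exact ⟨h⁻¹, by simp [mul_assoc]⟩
  trans := by
    rintro x _ _ ⟨h, rfl⟩ ⟨k, rfl⟩
    exact ⟨k * h, by simp [mul_assoc]⟩

theorem twistedConj_of_mk_eq {G : Type*} [Group G] {φ : G ≃* G} {x y : G}
    (h : Quot.mk (twistedConj φ) x = Quot.mk (twistedConj φ) y) : twistedConj φ x y :=
  (twistedConj_equivalence φ).eqvGen_iff.mp (Quot.eqvGen_exact h)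

/-- A copy of `G` carrying the twisted conjugation action `h • x = h * x * (φ h)⁻¹`. -/
def TwistedConjAct {G : Type*} [Group G] (_φ : G ≃* G) := G

namespace TwistedConjAct

variable {G : Type*} [Group G] (φ : G ≃* G)

instance : MulAction G (TwistedConjAct φ) where
  smul h x := h * (show G from x) * (φ h)⁻¹
  one_smul (x : G) := show 1 * x * (φ 1)⁻¹ = x by simp
  mul_smul h k (x : G) := show h * k * x * (φ (h * k))⁻¹ = h * (k * x * (φ k)⁻¹) * (φ h)⁻¹ by
    simp [mul_assoc]

/-- The identity map from `G`. -/
def of (x : G) : TwistedConjAct φ := x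

theorem smul_of (h x : G) : h • of φ x = of φ (h * x * (φ h)⁻¹) := rfl

theorem mem_stabilizer_one (h : G) : h ∈ MulAction.stabilizer G (of φ 1) ↔ φ h = h := by
  rw [MulAction.mem_stabilizer_iff, smul_of]
  change h * 1 * (φ h)⁻¹ = 1 ↔ _
  rw [mul_one, mul_inv_eq_one, eq_comm]

theorem card_orbits_le [Finite G] :
    Nat.card (MulAction.orbitRel.Quotient G (TwistedConjAct φ)) ≤
      Nat.card (ReidemeisterClasses φ) := by
  have : Finite (ReidemeisterClasses φ) := inferInstanceAs (Finite (Quot _))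
  refine Nat.card_le_card_of_surjective
    (Quot.lift (fun x => (Quotient.mk'' (of φ x) :
      MulAction.orbitRel.Quotient G (TwistedConjAct φ))) ?_) ?_
  · rintro x _ ⟨h, rfl⟩
    exact (Quotient.sound' (MulAction.orbitRel_apply.mpr ⟨h, rfl⟩)).symm
  · intro ω
    induction ω using Quotient.inductionOn' with
    | h x => exact ⟨Quot.mk _ x, rfl⟩

end TwistedConjAct

theorem exists_bound_card_fixed (r : ℕ) : ∃ B : ℕ, ∀ (F : Type*) [Group F] [Finite F]
    (φ : F ≃* F), Nat.card (ReidemeisterClasses φ) ≤ r → {x | φ x = x}.ncard ≤ B := by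
  obtain ⟨B, hB⟩ := exists_bound_of_sum_inv_eq r 1
  refine ⟨B, fun F _ _ φ hr => ?_⟩
  classical
  let X := TwistedConjAct φ
  have : Finite X := inferInstanceAs (Finite F)
  let Ω := MulAction.orbitRel.Quotient F X
  have : Fintype Ω := Fintype.ofFinite _
  have hF : (Nat.card F : ℚ) ≠ 0 := Nat.cast_ne_zero.mpr Nat.card_pos.ne'
  have horb (x : X) : Nat.card (MulAction.orbit F x) * Nat.card (MulAction.stabilizer F x) =
      Nat.card F := by
    have := Fintype.ofFinite F
    have := Fintype.ofFinite (MulAction.orbit F x)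
    have := Fintype.ofFinite (MulAction.stabilizer F x)
    simpa using MulAction.card_orbit_mul_card_stabilizer_eq_card_group F x
  let N (ω : Ω) : ℕ := Nat.card (MulAction.stabilizer F ω.out)
  have hsum : ∑ ω : Ω, (N ω : ℚ)⁻¹ = 1 := by
    have hcard : ∑ ω : Ω, Nat.card (MulAction.orbit F ω.out) = Nat.card F := by
      rw [← Nat.card_sigma]
      exact (Nat.card_congr (MulAction.selfEquivSigmaOrbits F X)).symm
    have hN (ω : Ω) : (N ω : ℚ)⁻¹ = Nat.card (MulAction.orbit F ω.out) / Nat.card F := by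
      have hpos : (N ω : ℚ) ≠ 0 := Nat.cast_ne_zero.mpr Nat.card_pos.ne'
      rw [eq_div_iff hF, ← horb ω.out, Nat.cast_mul, mul_comm, mul_assoc, mul_inv_cancel₀ hpos,
        mul_one]
    rw [Finset.sum_congr rfl fun ω _ => hN ω, ← Finset.sum_div, ← Nat.cast_sum, hcard,
      div_self hF]
  let ω₀ : Ω := Quotient.mk'' (TwistedConjAct.of φ 1)
  have hle : N ω₀ ≤ B := by
    refine hB (Finset.univ.val.map N) ?_ ?_ ?_ _ (Multiset.mem_map_of_mem N (Finset.mem_univ ω₀))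
    · rw [Multiset.card_map, Finset.card_val, Finset.card_univ, ← Nat.card_eq_fintype_card]
      exact (TwistedConjAct.card_orbits_le φ).trans hr
    · intro n hn
      obtain ⟨ω, -, rfl⟩ := Multiset.mem_map.mp hn
      exact Nat.card_pos
    · rw [Multiset.map_map]
      exact hsum
  have hrel : MulAction.orbitRel F X ω₀.out (TwistedConjAct.of φ 1) := Quotient.mk_out' _
  have hset : {x | φ x = x} = (MulAction.stabilizer F (TwistedConjAct.of φ 1) : Set F) := by
    ext x
    exact (TwistedConjAct.mem_stabilizer_one φ x).symm
  rw [hset, ← Nat.card_coe_set_eq]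
  exact (Nat.card_congr
    (MulAction.stabilizerEquivStabilizerOfOrbitRel hrel).toEquiv).symm.le.trans hle

theorem finite_monoidHom_of_fg (G F : Type*) [Group G] [Group F] [Finite F] (hG : Group.FG G) :
    Finite (G →* F) := by
  obtain ⟨S, hS, hfin⟩ := Group.fg_iff.mp hG
  have : Finite S := hfin
  refine Finite.of_injective (fun (f : G →* F) (s : S) => f s) fun f g hfg => ?_
  exact MonoidHom.eq_of_eqOn_dense hS fun s hs => congrFun hfg ⟨s, hs⟩

/-- In a finitely generated group every finite-index normal subgroup contains a finite-index
normal subgroup invariant under all automorphisms. -/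
theorem exists_finiteIndex_invariant_le {G : Type*} [Group G] (hG : Group.FG G)
    (N : Subgroup G) [N.Normal] [Finite (G ⧸ N)] :
    ∃ K : Subgroup G, K.Normal ∧ K.FiniteIndex ∧ K ≤ N ∧
      ∀ (φ : G ≃* G) (x : G), φ x ∈ K ↔ x ∈ K := by
  have := finite_monoidHom_of_fg G (G ⧸ N) hG
  refine ⟨⨅ f : G →* G ⧸ N, f.ker, Subgroup.normal_iInf_normal fun f => inferInstance,
    Subgroup.finiteIndex_iInf fun f => inferInstance, ?_, fun φ x => ?_⟩
  · exact (iInf_le _ (QuotientGroup.mk' N)).trans (QuotientGroup.ker_mk' N).le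
  · simp only [Subgroup.mem_iInf, MonoidHom.mem_ker]
    refine ⟨fun h f => ?_, fun h f => h (f.comp φ.toMonoidHom)⟩
    simpa using h (f.comp φ.symm.toMonoidHom)

/-- An automorphism with finite Reidemeister number of a finitely generated residually finite group
has finitely many fixed points. -/
theorem finite_fixed_of_finite_reidemeisterClasses {G : Type*} [Group G] (hG : Group.FG G)
    (hrf : ResiduallyFinite G) (φ : G ≃* G) [Finite (ReidemeisterClasses φ)] :
    {x | φ x = x}.Finite := by
  obtain ⟨B, hB⟩ := exists_bound_card_fixed (Nat.card (ReidemeisterClasses φ))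
  by_contra hinf
  obtain ⟨T, hT, hcard⟩ := Set.Infinite.exists_subset_card_eq hinf (B + 1)
  have hsep (g : G) : ∃ K : Subgroup G, K.Normal ∧ K.FiniteIndex ∧ (g ∈ K → g = 1) ∧
      ∀ x : G, φ x ∈ K ↔ x ∈ K := by
    by_cases hg : g = 1
    · exact ⟨⊤, inferInstance, inferInstance, fun _ => hg, by simp⟩
    · obtain ⟨N, hN, hfin, hgN⟩ := hrf g hg
      obtain ⟨K, hK, hKfin, hle, hinv⟩ := exists_finiteIndex_invariant_le hG N
      exact ⟨K, hK, hKfin, fun h => absurd (hle h) hgN, hinv φ⟩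
  choose K hKn hKf hKg hKφ using hsep
  let L : Subgroup G := ⨅ p : T × T, K ((p.1 : G)⁻¹ * p.2)
  have hLn : L.Normal := Subgroup.normal_iInf_normal fun p => hKn _
  have hLf : L.FiniteIndex := Subgroup.finiteIndex_iInf fun p => hKf _
  have hLφ (x : G) : φ x ∈ L ↔ x ∈ L := by simp only [L, Subgroup.mem_iInf, hKφ]
  have hmap : L.map (φ : G →* G) = L := by
    ext x
    exact Subgroup.mem_map_equiv.trans (by rw [← hLφ, MulEquiv.apply_symm_apply])
  let φL : G ⧸ L ≃* G ⧸ L := QuotientGroup.congr L L φ hmap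
  have hr : Nat.card (ReidemeisterClasses φL) ≤ Nat.card (ReidemeisterClasses φ) := by
    refine Nat.card_le_card_of_surjective
      (Quot.map (QuotientGroup.mk : G → G ⧸ L) ?_) ?_
    · rintro x _ ⟨h, rfl⟩
      exact ⟨QuotientGroup.mk h, rfl⟩
    · rintro ⟨⟨x⟩⟩
      exact ⟨Quot.mk _ x, rfl⟩
  have hinj : Set.InjOn (QuotientGroup.mk : G → G ⧸ L) T := by
    intro a ha b hb hab
    have hmem := Subgroup.mem_iInf.mp (QuotientGroup.eq.mp hab) (⟨a, ha⟩, ⟨b, hb⟩)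
    exact inv_mul_eq_one.mp (hKg _ hmem)
  have himage : (QuotientGroup.mk : G → G ⧸ L) '' T ⊆ {x | φL x = x} := by
    rintro _ ⟨x, hx, rfl⟩
    exact congrArg (QuotientGroup.mk : G → G ⧸ L) (hT hx)
  have hle := (Set.ncard_le_ncard himage (Set.toFinite _)).trans (hB (G ⧸ L) φL hr)
  rw [hinj.ncard_image, Set.ncard_coe_finset, hcard] at hle
  omega

theorem finite_reidemeisterClasses_trans_conj {G : Type*} [Group G] (φ : G ≃* G) (g : G)
    [Finite (ReidemeisterClasses φ)] :
    Finite (ReidemeisterClasses (φ.trans (MulAut.conj g))) := by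
  refine Finite.of_surjective (α := ReidemeisterClasses φ)
    (Quot.map (fun x => x * g⁻¹) ?_) ?_
  · rintro x _ ⟨h, rfl⟩
    exact ⟨h, by simp [mul_assoc]⟩
  · rintro ⟨x⟩
    exact ⟨Quot.mk _ (x * g), congrArg _ (mul_inv_cancel_right x g)⟩

/-- Given a `φ`-invariant normal subgroup `H` with `G ⧸ H` finitely generated residually
finite and induced automorphism `ψ` on `G ⧸ H`: `R(φ) < ∞` iff `R(ψ) < ∞` and
`R((τ_g ∘ φ)|_H) < ∞` for every `g ∈ G`. -/
theorem stmt5 {G : Type*} [Group G] (φ : G ≃* G) (H : Subgroup G) [H.Normal]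
    (hH : ∀ x : G, x ∈ H ↔ φ x ∈ H)
    (hfg : Group.FG (G ⧸ H)) (hrf : ResiduallyFinite (G ⧸ H))
    (ψ : (G ⧸ H) ≃* (G ⧸ H))
    (hψ : ∀ g : G, ψ (QuotientGroup.mk g) = QuotientGroup.mk (φ g)) :
    Finite (ReidemeisterClasses φ) ↔
      (Finite (ReidemeisterClasses ψ) ∧
       ∀ g : G, Finite (Quot (fun h₁ h₂ : H =>
         ∃ h : H, (h₂ : G) = ↑h * ↑h₁ * (g * φ ↑h * g⁻¹)⁻¹))) := by
  have hconj (g h x : G) : h * (x * g) * (φ h)⁻¹ = h * x * (g * φ h * g⁻¹)⁻¹ * g := by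
    simp [mul_assoc]
  constructor
  · intro hφ
    have hψfin : Finite (ReidemeisterClasses ψ) := by
      refine Finite.of_surjective (α := ReidemeisterClasses φ)
        (Quot.map (QuotientGroup.mk : G → G ⧸ H) ?_) ?_
      · rintro x _ ⟨h, rfl⟩
        exact ⟨QuotientGroup.mk h, by rw [hψ]; rfl⟩
      · rintro ⟨⟨x⟩⟩
        exact ⟨Quot.mk _ x, rfl⟩
    refine ⟨hψfin, fun g => ?_⟩
    have := finite_reidemeisterClasses_trans_conj ψ (g : G ⧸ H)
    have hfix := finite_fixed_of_finite_reidemeisterClasses hfg hrf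
      (ψ.trans (MulAut.conj (g : G ⧸ H)))
    set rel : H → H → Prop := fun h₁ h₂ =>
      ∃ h : H, (h₂ : G) = ↑h * ↑h₁ * (g * φ ↑h * g⁻¹)⁻¹
    let f : Quot rel → ReidemeisterClasses φ := Quot.map (fun h : H => (h : G) * g) (by
      rintro h₁ h₂ ⟨h, hh⟩
      exact ⟨h, by rw [hconj, hh]⟩)
    refine Set.finite_univ_iff.mp
      (Set.Finite.of_finite_fibers f (Set.toFinite _) fun c hc => ?_)
    obtain ⟨⟨h₀⟩, -, rfl⟩ := hc
    have hex (q : Quot rel) : ∃ k : G, f q = f (Quot.mk _ h₀) →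
        (q.out : G) * g = k * (h₀ * g) * (φ k)⁻¹ := by
      by_cases hq : f q = f (Quot.mk _ h₀)
      · rw [← q.out_eq] at hq
        obtain ⟨k, hk⟩ := twistedConj_of_mk_eq hq.symm
        exact ⟨k, fun _ => hk⟩
      · exact ⟨1, fun h => absurd h hq⟩
    choose k hk using hex
    refine Set.Finite.of_injOn (f := fun q => (k q : G ⧸ H)) ?_ ?_ hfix
    · rintro q ⟨-, hq⟩
      have h := congrArg (QuotientGroup.mk : G → G ⧸ H) (hk q hq)
      simp only [QuotientGroup.mk_mul, QuotientGroup.mk_inv, ← hψ,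
        (QuotientGroup.eq_one_iff _).mpr (SetLike.coe_mem _), one_mul] at h
      change (g : G ⧸ H) * ψ (k q) * (g : G ⧸ H)⁻¹ = k q
      rw [mul_inv_eq_iff_eq_mul, ← eq_mul_inv_iff_mul_eq]
      exact h
    · rintro q₁ ⟨-, hq₁⟩ q₂ ⟨-, hq₂⟩ h
      have hm : k q₂ * (k q₁)⁻¹ ∈ H := by
        rw [← QuotientGroup.eq_one_iff, QuotientGroup.mk_mul, QuotientGroup.mk_inv]
        exact mul_inv_eq_one.mpr h.symm
      rw [← q₁.out_eq, ← q₂.out_eq]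
      refine Quot.sound ⟨⟨_, hm⟩, mul_right_cancel (b := g) ?_⟩
      rw [← hconj, hk q₁ hq₁, hk q₂ hq₂]
      simp [mul_assoc]
  · rintro ⟨hψfin, hH'⟩
    let rel (g : G) : H → H → Prop := fun h₁ h₂ =>
      ∃ h : H, (h₂ : G) = ↑h * ↑h₁ * (g * φ ↑h * g⁻¹)⁻¹
    have (g : G) : Finite (Quot (rel g)) := hH' g
    let rep (c : ReidemeisterClasses ψ) : G := (Quot.out c).out
    have hlift (c : ReidemeisterClasses ψ) (h₁ h₂ : H) (h : rel (rep c) h₁ h₂) :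
        Quot.mk (twistedConj φ) ((h₁ : G) * rep c) = Quot.mk _ ((h₂ : G) * rep c) := by
      obtain ⟨k, hk⟩ := h
      exact Quot.sound ⟨k, by rw [hconj, hk]⟩
    refine Finite.of_surjective (α := Σ c : ReidemeisterClasses ψ, Quot (rel (rep c)))
      (fun p => Quot.lift (fun h : H => Quot.mk _ ((h : G) * rep p.1)) (hlift p.1) p.2) ?_
    rintro ⟨x⟩
    let c : ReidemeisterClasses ψ := Quot.mk _ (x : G ⧸ H)
    obtain ⟨⟨k⟩, hk⟩ := twistedConj_of_mk_eq (c.out_eq.symm : Quot.mk _ (x : G ⧸ H) = _)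
    have hmem : k * x * (φ k)⁻¹ * (rep c)⁻¹ ∈ H := by
      rw [← QuotientGroup.eq_one_iff]
      simp only [QuotientGroup.mk_mul, QuotientGroup.mk_inv, ← hψ]
      rw [mul_inv_eq_one]
      exact hk.symm.trans (Quotient.out_eq' c.out).symm
    refine ⟨⟨c, Quot.mk _ ⟨_, hmem⟩⟩, (Quot.sound ⟨k, ?_⟩ : Quot.mk _ x = _).symm⟩
    simp
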